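/- Let Γ = (V, E) be a directed graph with real edge weights w containing no negative-weight cycles, [n] ⊆ V, and let S ⊆ V with |S| = d such that some d-subset of [n] admits a linking onto S. Define μ(I) for I ∈ C([n], d) as the minimum total weight of a linking (collection of |I| vertex-disjoint paths) from I onto S, with μ(I) = ∞ if no linking exists. Then μ satisfies the tropical Plücker (valuated matroid exchange) relations: for all S' ∈ C([n], d−1) and T ∈ C([n], d+1), the minimum of μ(S' ∪ {t}) + μ(T \ {t}) over t ∈ T \ S' is attained at least twice. -/

import Mathlib

/-- A (simple) directed path in the digraph with edge relation `E`: a nonempty list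
of pairwise distinct vertices in which consecutive vertices are joined by edges. -/
def IsPathIn (E : ℕ → ℕ → Prop) (p : List ℕ) : Prop :=
  p ≠ [] ∧ p.Chain' E ∧ p.Nodup

/-- The weight of a path: the sum of the weights of its edges. -/
def pathWeight (w : ℕ → ℕ → ℝ) (p : List ℕ) : ℝ :=
  ((p.zip p.tail).map fun q => w q.1 q.2).sum

/-- A linking from `I` onto `S`: a collection `P` of `|I|` pairwise vertex-disjoint
paths, whose starting points are exactly the elements of `I` and whose endpoints are
exactly the elements of `S`. -/
def IsLinking (E : ℕ → ℕ → Prop) (I S : Finset ℕ) (P : Finset (List ℕ)) : Prop :=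
  (∀ p ∈ P, IsPathIn E p) ∧
  (∀ p ∈ P, ∀ q ∈ P, p ≠ q → ∀ v, v ∈ p → v ∉ q) ∧
  P.card = I.card ∧
  (∀ p ∈ P, ∃ x ∈ I, p.head? = some x) ∧
  (∀ x ∈ I, ∃ p ∈ P, p.head? = some x) ∧
  (∀ p ∈ P, ∃ y ∈ S, p.getLast? = some y) ∧
  (∀ y ∈ S, ∃ p ∈ P, p.getLast? = some y)

/-- The total weight of a linking. -/
def linkingWeight (w : ℕ → ℕ → ℝ) (P : Finset (List ℕ)) : ℝ :=
  ∑ p ∈ P, pathWeight w p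

/-- The cost of sending `u` to `v`: staying put is free, moving costs the edge weight. -/
def stepCost (w : ℕ → ℕ → ℝ) (u v : ℕ) : ℝ := if v = u then 0 else w u v

/-- A family of disjoint paths `x :: q x`, for `x ∈ I`, inside `V`, with endpoints `S`. -/
structure IsPathSystem (E : ℕ → ℕ → Prop) (V I S : Finset ℕ) (q : ℕ → List ℕ) : Prop where
  path : ∀ x ∈ I, IsPathIn E (x :: q x)
  mem : ∀ x ∈ I, ∀ v ∈ x :: q x, v ∈ V
  disj : ∀ x ∈ I, ∀ y ∈ I, ∀ v ∈ x :: q x, v ∈ y :: q y → x = y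
  last : ∀ x ∈ I, (q x).getLastD x ∈ S
  surj : ∀ y ∈ S, ∃ x ∈ I, (q x).getLastD x = y

/-- A bijection from `V \ S` onto `V \ I` each of whose moves is trivial or along an edge. -/
structure IsStepMap (E : ℕ → ℕ → Prop) (V I S : Finset ℕ) (f : ℕ → ℕ) : Prop where
  inj : Set.InjOn f (V \ S : Finset ℕ)
  image : (V \ S).image f = V \ I
  step : ∀ u ∈ V \ S, f u = u ∨ E u (f u)

lemma pathWeight_cons_cons (w : ℕ → ℕ → ℝ) (x y : ℕ) (l : List ℕ) :
    pathWeight w (x :: y :: l) = w x y + pathWeight w (y :: l) := by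
  simp [pathWeight]

lemma IsPathSystem.target_subset {E : ℕ → ℕ → Prop} {V I S : Finset ℕ} {q : ℕ → List ℕ}
    (h : IsPathSystem E V I S q) : S ⊆ V := by
  intro y hy
  obtain ⟨x, hx, rfl⟩ := h.surj y hy
  exact h.mem x hx _ (List.getLastD_mem_cons)

lemma IsPathSystem.source_subset {E : ℕ → ℕ → Prop} {V I S : Finset ℕ} {q : ℕ → List ℕ}
    (h : IsPathSystem E V I S q) : I ⊆ V :=
  fun x hx => h.mem x hx x (by simp)

lemma IsPathSystem.mono {E : ℕ → ℕ → Prop} {V V' I S : Finset ℕ} {q : ℕ → List ℕ}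
    (h : IsPathSystem E V I S q) (hV : V ⊆ V') : IsPathSystem E V' I S q :=
  ⟨h.path, fun x hx v hv => hV (h.mem x hx v hv), h.disj, h.last, h.surj⟩

/-- A linking is the same as a path system. -/
lemma IsLinking.exists_isPathSystem {E : ℕ → ℕ → Prop} (w : ℕ → ℕ → ℝ) {I S : Finset ℕ}
    {P : Finset (List ℕ)} (h : IsLinking E I S P) :
    ∃ V q, IsPathSystem E V I S q ∧ ∑ x ∈ I, pathWeight w (x :: q x) = linkingWeight w P := by
  obtain ⟨hpath, hdisj, -, hhead, hstart, hlast, hsurj⟩ := h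
  have hstart' : ∀ x, ∃ l, x ∈ I → x :: l ∈ P := by
    intro x
    by_cases hx : x ∈ I
    · obtain ⟨p, hp, hpx⟩ := hstart x hx
      rcases p with _ | ⟨a, l⟩
      · simp at hpx
      · simp only [List.head?_cons, Option.some.injEq] at hpx
        subst hpx
        exact ⟨l, fun _ => hp⟩
    · exact ⟨[], fun hx' => absurd hx' hx⟩
  choose q hq using hstart'
  have himage : I.image (fun x => x :: q x) = P := by
    ext p
    simp only [Finset.mem_image]
    constructor
    · rintro ⟨x, hx, rfl⟩
      exact hq x hx
    · intro hp
      obtain ⟨x, hx, hpx⟩ := hhead p hp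
      refine ⟨x, hx, ?_⟩
      by_contra hne
      refine hdisj _ (hq x hx) p hp hne x (by simp) ?_
      exact List.mem_of_head? hpx
  refine ⟨P.biUnion List.toFinset, q, ⟨fun x hx => hpath _ (hq x hx), ?_, ?_, ?_, ?_⟩, ?_⟩
  · intro x hx v hv
    exact Finset.mem_biUnion.2 ⟨_, hq x hx, by simpa using hv⟩
  · intro x hx y hy v hv hv'
    by_contra hne
    exact hdisj _ (hq x hx) _ (hq y hy) (by simp [hne]) v hv hv'
  · intro x hx
    obtain ⟨y, hy, hxy⟩ := hlast _ (hq x hx)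
    rw [List.getLast?_cons, Option.some.injEq, ← List.getLastD_eq_getLast?] at hxy
    exact hxy ▸ hy
  · intro y hy
    obtain ⟨p, hp, hpy⟩ := hsurj y hy
    rw [← himage, Finset.mem_image] at hp
    obtain ⟨x, hx, rfl⟩ := hp
    rw [List.getLast?_cons, Option.some.injEq, ← List.getLastD_eq_getLast?] at hpy
    exact ⟨x, hx, hpy⟩
  · rw [linkingWeight, ← himage, Finset.sum_image]
    intro x _ y _ hxy
    exact (List.cons.inj hxy).1

lemma IsPathSystem.exists_isLinking {E : ℕ → ℕ → Prop} (w : ℕ → ℕ → ℝ) {V I S : Finset ℕ}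
    {q : ℕ → List ℕ} (h : IsPathSystem E V I S q) :
    ∃ P, IsLinking E I S P ∧ linkingWeight w P = ∑ x ∈ I, pathWeight w (x :: q x) := by
  have hinj : Function.Injective fun x => x :: q x := fun x y hxy => (List.cons.inj hxy).1
  refine ⟨I.image fun x => x :: q x, ⟨?_, ?_, ?_, ?_, ?_, ?_, ?_⟩, ?_⟩
  · simpa using h.path
  · intro p hp p' hp' hne v hv hv'
    obtain ⟨x, hx, rfl⟩ := Finset.mem_image.1 hp
    obtain ⟨y, hy, rfl⟩ := Finset.mem_image.1 hp'
    exact hne (by rw [h.disj x hx y hy v hv hv'])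
  · exact Finset.card_image_of_injective _ hinj
  · simp
  · simp
  · intro p hp
    obtain ⟨x, hx, rfl⟩ := Finset.mem_image.1 hp
    exact ⟨_, h.last x hx, by rw [List.getLast?_cons, ← List.getLastD_eq_getLast?]⟩
  · intro y hy
    obtain ⟨x, hx, hxy⟩ := h.surj y hy
    exact ⟨_, Finset.mem_image_of_mem _ hx,
      by rw [List.getLast?_cons, ← List.getLastD_eq_getLast?, hxy]⟩
  · rw [linkingWeight, Finset.sum_image (fun x _ y _ hxy => hinj hxy)]

lemma IsPathSystem.exists_isStepMap {E : ℕ → ℕ → Prop} (w : ℕ → ℕ → ℝ) {S : Finset ℕ}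
    (V : Finset ℕ) : ∀ {I : Finset ℕ} {q : ℕ → List ℕ}, IsPathSystem E V I S q →
    ∃ f, IsStepMap E V I S f ∧
      ∑ u ∈ V \ S, stepCost w u (f u) = ∑ x ∈ I, pathWeight w (x :: q x) := by
  induction V using Finset.strongInduction with
  | H V ih =>
  intro I q h
  by_cases htriv : ∀ x ∈ I, q x = []
  · have hIS : I = S := by
      ext x
      constructor
      · intro hx
        simpa [htriv x hx] using h.last x hx
      · intro hx
        obtain ⟨y, hy, hyx⟩ := h.surj x hx
        rw [htriv y hy] at hyx
        simpa [← hyx] using hy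
    refine ⟨id, ⟨Function.injective_id.injOn, by simp [hIS], fun u _ => Or.inl rfl⟩, ?_⟩
    rw [Finset.sum_eq_zero (by simp [stepCost]), Finset.sum_eq_zero]
    intro x hx
    simp [htriv x hx, pathWeight]
  push Not at htriv
  obtain ⟨x, hx, hqx⟩ := htriv
  obtain ⟨y, l, hl⟩ := List.exists_cons_of_ne_nil hqx
  obtain ⟨-, hchain, hnodup⟩ := h.path x hx
  rw [hl] at hchain hnodup
  have hxV : x ∈ V := h.source_subset hx
  have hyx : y ≠ x := by rintro rfl; simp at hnodup
  have hyI : y ∉ I := fun hy => hyx (h.disj x hx y hy y (by simp [hl]) (by simp)).symm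
  have hyV : y ∈ V := h.mem x hx y (by simp [hl])
  have hxS : x ∉ S := by
    intro hxS
    obtain ⟨z, hz, hzx⟩ := h.surj x hxS
    have hzx' := h.disj z hz x hx x (hzx ▸ List.getLastD_mem_cons) (by simp)
    subst hzx'
    rw [hl, List.getLastD_cons] at hzx
    exact (List.nodup_cons.1 hnodup).1 (hzx ▸ List.getLastD_mem_cons)
  have hne : ∀ {z}, z ∈ I.erase x → z ≠ y := fun hz hzy =>
    hyI (hzy ▸ Finset.mem_of_mem_erase hz)
  have h' : IsPathSystem E (V.erase x) (insert y (I.erase x)) S (Function.update q y l) := by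
    refine ⟨?_, ?_, ?_, ?_, ?_⟩
    · intro z hz
      rcases Finset.mem_insert.1 hz with rfl | hz
      · simp only [Function.update_self]
        exact ⟨by simp, hchain.tail, hnodup.tail⟩
      · rw [Function.update_of_ne (hne hz)]
        exact h.path z (Finset.mem_of_mem_erase hz)
    · intro z hz v hv
      rcases Finset.mem_insert.1 hz with rfl | hz
      · simp only [Function.update_self] at hv
        refine Finset.mem_erase.2 ⟨?_, h.mem x hx v (by rw [hl]; exact List.mem_cons_of_mem _ hv)⟩
        rintro rfl
        exact (List.nodup_cons.1 hnodup).1 hv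
      · rw [Function.update_of_ne (hne hz)] at hv
        have hz' := Finset.mem_of_mem_erase hz
        refine Finset.mem_erase.2 ⟨?_, h.mem z hz' v hv⟩
        rintro rfl
        exact Finset.ne_of_mem_erase hz (h.disj z hz' v hx v hv (by simp))
    · intro z hz z' hz' v hv hv'
      rcases Finset.mem_insert.1 hz with rfl | hz₁ <;> rcases Finset.mem_insert.1 hz' with rfl | hz₁'
      · rfl
      · simp only [Function.update_self] at hv
        rw [Function.update_of_ne (hne hz₁')] at hv'
        exact absurd (h.disj _ (Finset.mem_of_mem_erase hz₁') x hx v hv'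
          (by rw [hl]; exact List.mem_cons_of_mem _ hv)) (Finset.ne_of_mem_erase hz₁')
      · simp only [Function.update_self] at hv'
        rw [Function.update_of_ne (hne hz₁)] at hv
        exact absurd (h.disj _ (Finset.mem_of_mem_erase hz₁) x hx v hv
          (by rw [hl]; exact List.mem_cons_of_mem _ hv')) (Finset.ne_of_mem_erase hz₁)
      · rw [Function.update_of_ne (hne hz₁)] at hv
        rw [Function.update_of_ne (hne hz₁')] at hv'
        exact h.disj z (Finset.mem_of_mem_erase hz₁) z' (Finset.mem_of_mem_erase hz₁') v hv hv'
    · intro z hz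
      rcases Finset.mem_insert.1 hz with rfl | hz
      · simpa only [hl, Function.update_self, List.getLastD_cons] using h.last x hx
      · rw [Function.update_of_ne (hne hz)]
        exact h.last z (Finset.mem_of_mem_erase hz)
    · intro s hs
      obtain ⟨z, hz, hzs⟩ := h.surj s hs
      by_cases hzx : z = x
      · subst hzx
        exact ⟨y, by simp, by simpa only [hl, Function.update_self, List.getLastD_cons] using hzs⟩
      · have hz' : z ∈ I.erase x := Finset.mem_erase.2 ⟨hzx, hz⟩
        exact ⟨z, Finset.mem_insert_of_mem hz', by rwa [Function.update_of_ne (hne hz')]⟩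
  obtain ⟨f, hf, hsum⟩ := ih _ (Finset.erase_ssubset hxV) h'
  have hU : V \ S = insert x (V.erase x \ S) := by
    ext z; simp only [Finset.mem_sdiff, Finset.mem_insert, Finset.mem_erase]; grind
  have hxU : x ∉ V.erase x \ S := by simp
  have hcongr : ∀ u ∈ V.erase x \ S, Function.update f x y u = f u := by
    intro u hu
    exact Function.update_of_ne (ne_of_mem_of_not_mem hu hxU) _ _
  have himage : (V.erase x \ S).image (Function.update f x y) =
      V.erase x \ insert y (I.erase x) := by
    rw [← hf.image]
    exact Finset.image_congr hcongr
  refine ⟨Function.update f x y, ⟨?_, ?_, ?_⟩, ?_⟩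
  · rw [hU, Finset.coe_insert, Set.injOn_insert (by simp)]
    refine ⟨hf.inj.congr fun u hu => (hcongr u hu).symm, ?_⟩
    rw [← Finset.coe_image, himage]
    simp
  · rw [hU, Finset.image_insert, himage]
    ext z; simp only [Function.update_self, Finset.mem_sdiff, Finset.mem_insert, Finset.mem_erase]
    grind
  · intro u hu
    rw [hU, Finset.mem_insert] at hu
    rcases hu with rfl | hu
    · simp only [Function.update_self]
      exact Or.inr (List.isChain_cons_cons.1 hchain).1
    · rw [hcongr u hu]
      exact hf.step u hu
  · rw [hU, Finset.sum_insert hxU, Finset.sum_congr rfl (fun u hu => by rw [hcongr u hu]), hsum,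
      Finset.sum_insert (by simp [hyI]), ← Finset.add_sum_erase I _ hx, hl, pathWeight_cons_cons]
    simp only [Function.update_self, stepCost, if_neg hyx]
    rw [Finset.sum_congr rfl fun z hz => by rw [Function.update_of_ne (hne hz)]]
    ring

lemma pathWeight_map_range (w : ℕ → ℕ → ℝ) (g : ℕ → ℕ) (k : ℕ) :
    pathWeight w ((List.range (k + 1)).map g) = ∑ i ∈ Finset.range k, w (g i) (g (i + 1)) := by
  induction k generalizing g with
  | zero => simp [pathWeight]
  | succ k ih =>
    have h := ih (g ∘ Nat.succ)
    rw [List.range_succ_eq_map, List.map_cons, List.map_map] at h ⊢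
    rw [List.range_succ_eq_map, List.map_cons, pathWeight_cons_cons, Finset.sum_range_succ',
      List.map_map, h]
    simp [add_comm]

/-- Without negative cycles, a permutation moving vertices along edges has nonnegative cost. -/
lemma sum_stepCost_perm_nonneg {E : ℕ → ℕ → Prop} {w : ℕ → ℕ → ℝ}
    (hw : ∀ p : List ℕ, p.IsChain E → 2 ≤ p.length → p.head? = p.getLast? → 0 ≤ pathWeight w p)
    {U : Finset ℕ} (σ : Equiv.Perm U) (hσ : ∀ u : U, σ u = u ∨ E u (σ u)) :
    0 ≤ ∑ u : U, stepCost w u (σ u) := by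
  have hN : 0 < orderOf σ := orderOf_pos σ
  have hwalk : ∀ u : U,
      0 ≤ ∑ i ∈ Finset.range (orderOf σ), stepCost w ((σ ^ i) u) ((σ ^ (i + 1)) u) := by
    intro u
    have hsucc : ∀ i, (σ ^ (i + 1)) u = (σ ^ i) (σ u) := fun i => by rw [pow_succ]; rfl
    by_cases hu : σ u = u
    · exact Finset.sum_nonneg fun i _ => by simp [stepCost, hsucc, hu]
    have hne : ∀ i, (σ ^ (i + 1)) u ≠ (σ ^ i) u := fun i h => by
      rw [hsucc] at h
      exact hu ((σ ^ i).injective h)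
    have hE : ∀ i, E ((σ ^ i) u) ((σ ^ (i + 1)) u) := fun i => by
      have h := hσ ((σ ^ i) u)
      rw [← Equiv.Perm.mul_apply, ← pow_succ'] at h
      exact h.resolve_left (hne i)
    have h := hw ((List.range (orderOf σ + 1)).map fun i => ((σ ^ i) u : ℕ)) ?_ ?_ ?_
    · rw [pathWeight_map_range] at h
      refine h.trans_eq (Finset.sum_congr rfl fun i _ => ?_)
      rw [stepCost, if_neg fun h' => hne i (Subtype.ext h')]
    · rw [List.isChain_map, List.isChain_iff_getElem]
      intro i hi
      simpa using hE i
    · simp; omega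
    · simp [List.range_succ, List.head?_range, hN.ne', pow_orderOf_eq_one]
  have hsum : ∑ u : U, ∑ i ∈ Finset.range (orderOf σ),
      stepCost w ((σ ^ i) u) ((σ ^ (i + 1)) u) = orderOf σ * ∑ u : U, stepCost w u (σ u) := by
    rw [Finset.sum_comm, ← nsmul_eq_mul]
    conv_rhs => rw [← Finset.card_range (orderOf σ)]
    refine Finset.sum_eq_card_nsmul fun i _ => ?_
    rw [← Equiv.sum_comp (σ ^ i) fun u => stepCost w u (σ u)]
    simp [pow_succ']
  have h := Finset.sum_nonneg fun u (_ : u ∈ Finset.univ) => hwalk u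
  rw [hsum] at h
  exact nonneg_of_mul_nonneg_right h (by exact_mod_cast hN)

lemma sum_stepCost_nonneg {E : ℕ → ℕ → Prop} {w : ℕ → ℕ → ℝ}
    (hw : ∀ p : List ℕ, p.IsChain E → 2 ≤ p.length → p.head? = p.getLast? → 0 ≤ pathWeight w p)
    {V S : Finset ℕ} {f : ℕ → ℕ} (hf : IsStepMap E V S S f) :
    0 ≤ ∑ u ∈ V \ S, stepCost w u (f u) := by
  have hmaps : Set.MapsTo f (V \ S : Finset ℕ) (V \ S : Finset ℕ) := fun u hu => by
    have := Finset.mem_image_of_mem f hu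
    rwa [hf.image] at this
  let σ : Equiv.Perm (V \ S : Finset ℕ) := Equiv.ofBijective (hmaps.restrict f _ _)
    (Finite.injective_iff_bijective.1 (hmaps.restrict_inj.2 hf.inj))
  have hσ : ∀ u, (σ u : ℕ) = f u := fun u => rfl
  rw [← Finset.sum_coe_sort]
  refine sum_stepCost_perm_nonneg hw σ fun u => ?_
  rw [Subtype.ext_iff, hσ]
  exact hf.step u u.2

lemma IsStepMap.exists_isPathSystem {E : ℕ → ℕ → Prop} {w : ℕ → ℕ → ℝ}
    (hw : ∀ p : List ℕ, p.IsChain E → 2 ≤ p.length → p.head? = p.getLast? → 0 ≤ pathWeight w p)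
    {S : Finset ℕ} (V : Finset ℕ) :
    ∀ {I : Finset ℕ} {f : ℕ → ℕ}, S ⊆ V → I ⊆ V → IsStepMap E V I S f →
    ∃ q, IsPathSystem E V I S q ∧
      ∑ x ∈ I, pathWeight w (x :: q x) ≤ ∑ u ∈ V \ S, stepCost w u (f u) := by
  induction V using Finset.strongInduction with
  | H V ih =>
  intro I f hSV hIV hf
  by_cases hIS : I ⊆ S
  · have hcard : S.card ≤ I.card := by
      have h := Finset.card_image_of_injOn hf.inj
      rw [hf.image] at h
      have h1 := Finset.card_sdiff_add_card_eq_card hSV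
      have h2 := Finset.card_sdiff_add_card_eq_card hIV
      omega
    obtain rfl := Finset.eq_of_subset_of_card_le hIS hcard
    refine ⟨fun _ => [], ⟨?_, ?_, ?_, ?_, ?_⟩, ?_⟩
    · exact fun x _ => ⟨by simp, List.isChain_singleton x, List.nodup_singleton x⟩
    · simpa using fun x hx => hIV hx
    · intro x _ y _ v hv hv'
      simp only [List.mem_singleton] at hv hv'
      exact hv.symm.trans hv'
    · simp
    · simp
    · refine le_trans (le_of_eq ?_) (sum_stepCost_nonneg hw hf)
      simp [pathWeight]
  obtain ⟨x, hx, hxS⟩ := Finset.not_subset.1 hIS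
  have hxV := hIV hx
  have hxU : x ∈ V \ S := Finset.mem_sdiff.2 ⟨hxV, hxS⟩
  have hy : f x ∈ V \ I := hf.image ▸ Finset.mem_image_of_mem f hxU
  obtain ⟨hyV, hyI⟩ := Finset.mem_sdiff.1 hy
  have hyx : f x ≠ x := fun h => hyI (h.symm ▸ hx)
  have hE : E x (f x) := (hf.step x hxU).resolve_left hyx
  set y := f x
  have hU : V.erase x \ S = (V \ S).erase x := by
    ext z; simp only [Finset.mem_sdiff, Finset.mem_erase]; tauto
  have hf' : IsStepMap E (V.erase x) (insert y (I.erase x)) S f := by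
    refine ⟨?_, ?_, ?_⟩
    · rw [hU]
      exact hf.inj.mono (by simp)
    · have h : ((V \ S).erase x).image f = (V \ I).erase y := by
        rw [← hf.image]
        ext z
        simp only [Finset.mem_image, Finset.mem_erase]
        constructor
        · rintro ⟨u, ⟨hux, hu⟩, rfl⟩
          exact ⟨fun h => hux (hf.inj hu hxU h), u, hu, rfl⟩
        · rintro ⟨hz, u, hu, rfl⟩
          exact ⟨u, ⟨fun h => hz (h ▸ rfl), hu⟩, rfl⟩
      rw [hU, h]
      ext z; simp only [Finset.mem_sdiff, Finset.mem_insert, Finset.mem_erase]; grind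
    · intro u hu
      rw [hU] at hu
      exact hf.step u (Finset.mem_of_mem_erase hu)
  obtain ⟨q, hq, hsum⟩ := ih _ (Finset.erase_ssubset hxV)
    (fun s hs => Finset.mem_erase.2 ⟨fun h => hxS (h ▸ hs), hSV hs⟩)
    (Finset.insert_subset (Finset.mem_erase.2 ⟨hyx, hyV⟩) (Finset.erase_subset_erase _ hIV)) hf'
  have hyI' : y ∈ insert y (I.erase x) := by simp
  have hxq : ∀ z ∈ insert y (I.erase x), x ∉ z :: q z := fun z hz h =>
    Finset.notMem_erase x V (hq.mem z hz x h)
  have hsub : ∀ z ∈ I, z ≠ x → z ∈ insert y (I.erase x) := fun z hz hzx =>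
    Finset.mem_insert_of_mem (Finset.mem_erase.2 ⟨hzx, hz⟩)
  have hupd : ∀ z, z ≠ x → Function.update q x (y :: q y) z = q z := fun z hz =>
    Function.update_of_ne hz _ _
  have hyne : ∀ z ∈ I, z ≠ y := fun z hz h => hyI (h ▸ hz)
  refine ⟨Function.update q x (y :: q y), ⟨?_, ?_, ?_, ?_, ?_⟩, ?_⟩
  · intro z hz
    by_cases hzx : z = x
    · subst hzx
      obtain ⟨-, hc, hn⟩ := hq.path y hyI'
      rw [Function.update_self]
      exact ⟨by simp, List.isChain_cons_cons.2 ⟨hE, hc⟩, List.nodup_cons.2 ⟨hxq y hyI', hn⟩⟩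
    · rw [hupd z hzx]
      exact hq.path z (hsub z hz hzx)
  · intro z hz v hv
    by_cases hzx : z = x
    · subst hzx
      rw [Function.update_self] at hv
      rcases List.mem_cons.1 hv with rfl | hv
      · exact hxV
      · exact Finset.mem_of_mem_erase (hq.mem y hyI' v hv)
    · rw [hupd z hzx] at hv
      exact Finset.mem_of_mem_erase (hq.mem z (hsub z hz hzx) v hv)
  · have key : ∀ z ∈ I, z ≠ x → ∀ v ∈ x :: y :: q y, v ∉ z :: q z := by
      intro z hz hzx v hv hv'
      rcases List.mem_cons.1 hv with rfl | hv
      · exact hxq z (hsub z hz hzx) hv'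
      · exact hyne z hz (hq.disj z (hsub z hz hzx) y hyI' v hv' hv)
    intro z hz z' hz' v hv hv'
    by_cases hzx : z = x <;> by_cases hzx' : z' = x
    · rw [hzx, hzx']
    · subst hzx
      rw [Function.update_self] at hv
      rw [hupd z' hzx'] at hv'
      exact absurd hv' (key z' hz' hzx' v hv)
    · subst hzx'
      rw [Function.update_self] at hv'
      rw [hupd z hzx] at hv
      exact absurd hv (key z hz hzx v hv')
    · rw [hupd z hzx] at hv
      rw [hupd z' hzx'] at hv'
      exact hq.disj z (hsub z hz hzx) z' (hsub z' hz' hzx') v hv hv'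
  · intro z hz
    by_cases hzx : z = x
    · subst hzx
      rw [Function.update_self, List.getLastD_cons]
      exact hq.last y hyI'
    · rw [hupd z hzx]
      exact hq.last z (hsub z hz hzx)
  · intro s hs
    obtain ⟨z, hz, hzs⟩ := hq.surj s hs
    rcases Finset.mem_insert.1 hz with rfl | hz
    · exact ⟨x, hx, by rwa [Function.update_self, List.getLastD_cons]⟩
    · exact ⟨z, Finset.mem_of_mem_erase hz, by rwa [hupd z (Finset.ne_of_mem_erase hz)]⟩
  · rw [hU, Finset.sum_insert (by simp [hyI])] at hsum
    rw [← Finset.add_sum_erase I _ hx, ← Finset.add_sum_erase (V \ S) _ hxU, Function.update_self,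
      pathWeight_cons_cons, Finset.sum_congr rfl fun z hz => by
        rw [hupd z (Finset.ne_of_mem_erase hz)]]
    have hc : stepCost w x (f x) = w x y := if_neg hyx
    rw [hc]
    linarith

/-- Exchange of values along the alternating path of two injections that starts at `t`. -/
lemma exists_swap_of_injOn {α β : Type*} [DecidableEq α] [DecidableEq β] (U : Finset α) :
    ∀ {f g : α → β}, Set.InjOn f U → Set.InjOn g U → ∀ t ∈ U.image g, t ∉ U.image f →
    ∃ t' ∈ U.image f, t' ∉ U.image g ∧ ∃ f' g' : α → β,
      Set.InjOn f' U ∧ Set.InjOn g' U ∧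
      U.image f' = insert t ((U.image f).erase t') ∧
      U.image g' = insert t' ((U.image g).erase t) ∧
      ∀ u ∈ U, f' u = f u ∧ g' u = g u ∨ f' u = g u ∧ g' u = f u := by
  induction U using Finset.strongInduction with
  | H U ih =>
  intro f g hf hg t ht htf
  obtain ⟨a, ha, rfl⟩ := Finset.mem_image.1 ht
  have herase : ∀ {h : α → β}, Set.InjOn h U → (U.erase a).image h = (U.image h).erase (h a) := by
    intro h hh
    ext z
    simp only [Finset.mem_image, Finset.mem_erase]
    constructor
    · rintro ⟨u, ⟨hua, hu⟩, rfl⟩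
      exact ⟨fun e => hua (hh hu ha e), u, hu, rfl⟩
    · rintro ⟨hz, u, hu, rfl⟩
      exact ⟨u, ⟨fun e => hz (e ▸ rfl), hu⟩, rfl⟩
  have hfa : f a ∈ U.image f := Finset.mem_image_of_mem f ha
  have hne : f a ≠ g a := fun h => htf (h ▸ hfa)
  have hextend : ∀ {h : α → β} {b : β} {B : Finset β}, Set.InjOn h (U.erase a : Finset α) →
      (U.erase a).image h = B → b ∉ B → Set.InjOn (Function.update h a b) U ∧
      U.image (Function.update h a b) = insert b B := by
    intro h b B hh hB hb
    have hcongr : ∀ u ∈ U.erase a, Function.update h a b u = h u := fun u hu =>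
      Function.update_of_ne (Finset.ne_of_mem_erase hu) _ _
    have himage : (U.erase a).image (Function.update h a b) = B := by
      rw [← hB]
      exact Finset.image_congr hcongr
    rw [← Finset.insert_erase ha, Finset.image_insert, himage, Finset.coe_insert,
      Set.injOn_insert (by simp), ← Finset.coe_image, himage, Function.update_self]
    exact ⟨⟨hh.congr fun u hu => (hcongr u hu).symm, by simpa using hb⟩, rfl⟩
  have hf₁ : Set.InjOn f (U.erase a : Finset α) := hf.mono (by simp)
  have hg₁ : Set.InjOn g (U.erase a : Finset α) := hg.mono (by simp)
  by_cases hfg : f a ∈ U.image g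
  · have h1 : f a ∈ (U.erase a).image g := by
      rw [herase hg]; exact Finset.mem_erase.2 ⟨hne, hfg⟩
    have h2 : f a ∉ (U.erase a).image f := by
      rw [herase hf]; simp
    obtain ⟨t', ht', htg', f₁, g₁, hfi, hgi, hfim, hgim, hswap⟩ :=
      ih _ (Finset.erase_ssubset ha) hf₁ hg₁ (f a) h1 h2
    rw [herase hf] at ht' hfim
    rw [herase hg] at htg' hgim
    obtain ⟨htne, ht'⟩ := Finset.mem_erase.1 ht'
    have htg : t' ≠ g a := fun h => htf (h ▸ ht')
    have hf' := hextend (b := g a) hfi hfim (by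
      simp only [Finset.mem_insert, Finset.mem_erase]; tauto)
    have hg' := hextend (b := f a) hgi hgim (by simp [htne.symm])
    refine ⟨t', ht', fun h => htg' (Finset.mem_erase.2 ⟨htg, h⟩), _, _, hf'.1, hg'.1, ?_, ?_, ?_⟩
    · rw [hf'.2]
      ext z; simp only [Finset.mem_insert, Finset.mem_erase]; grind
    · rw [hg'.2]
      ext z; simp only [Finset.mem_insert, Finset.mem_erase]; grind
    · intro u hu
      by_cases hua : u = a
      · subst hua; simp
      · rw [Function.update_of_ne hua, Function.update_of_ne hua]
        exact hswap u (Finset.mem_erase.2 ⟨hua, hu⟩)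
  · have hf' := hextend (b := g a) hf₁ (herase hf) (fun h => htf (Finset.mem_of_mem_erase h))
    have hg' := hextend (b := f a) hg₁ (herase hg) (fun h => hfg (Finset.mem_of_mem_erase h))
    refine ⟨f a, hfa, hfg, _, _, hf'.1, hg'.1, hf'.2, hg'.2, fun u _ => ?_⟩
    by_cases hua : u = a
    · subst hua; simp
    · simp [Function.update_of_ne hua]

/-- The exchange property of minimum-weight linkings. -/
lemma IsLinking.exchange {E : ℕ → ℕ → Prop} {w : ℕ → ℕ → ℝ}
    (hw : ∀ p : List ℕ, p.IsChain E → 2 ≤ p.length → p.head? = p.getLast? → 0 ≤ pathWeight w p)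
    {I J S : Finset ℕ} {P Q : Finset (List ℕ)} (hP : IsLinking E I S P) (hQ : IsLinking E J S Q)
    {t : ℕ} (ht : t ∈ I) (htJ : t ∉ J) :
    ∃ t' ∈ J, t' ∉ I ∧ ∃ P' Q', IsLinking E (insert t' (I.erase t)) S P' ∧
      IsLinking E (insert t (J.erase t')) S Q' ∧
      linkingWeight w P' + linkingWeight w Q' ≤ linkingWeight w P + linkingWeight w Q := by
  obtain ⟨V₁, p, hp, hpw⟩ := hP.exists_isPathSystem w
  obtain ⟨V₂, q, hq, hqw⟩ := hQ.exists_isPathSystem w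
  replace hp := hp.mono (Finset.subset_union_left (s₂ := V₂))
  replace hq := hq.mono (Finset.subset_union_right (s₁ := V₁))
  set V := V₁ ∪ V₂
  have hSV := hp.target_subset
  have hIV := hp.source_subset
  have hJV := hq.source_subset
  obtain ⟨f, hf, hfw⟩ := hp.exists_isStepMap w
  obtain ⟨g, hg, hgw⟩ := hq.exists_isStepMap w
  obtain ⟨t', ht', htg', f', g', hfi, hgi, hfim, hgim, hswap⟩ :=
    exists_swap_of_injOn (V \ S) hf.inj hg.inj t
      (by rw [hg.image]; exact Finset.mem_sdiff.2 ⟨hIV ht, htJ⟩) (by rw [hf.image]; simp [ht])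
  rw [hf.image] at ht' hfim
  rw [hg.image] at htg' hgim
  obtain ⟨htV', htI'⟩ := Finset.mem_sdiff.1 ht'
  have htJ' : t' ∈ J := by
    by_contra h
    exact htg' (Finset.mem_sdiff.2 ⟨htV', h⟩)
  have htV := hIV ht
  have hf' : IsStepMap E V (insert t' (I.erase t)) S f' := by
    refine ⟨hfi, ?_, fun u hu => ?_⟩
    · rw [hfim]
      ext z; simp only [Finset.mem_sdiff, Finset.mem_insert, Finset.mem_erase]; grind
    · rcases hswap u hu with h | h <;> rw [h.1]
      exacts [hf.step u hu, hg.step u hu]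
  have hg' : IsStepMap E V (insert t (J.erase t')) S g' := by
    refine ⟨hgi, ?_, fun u hu => ?_⟩
    · rw [hgim]
      ext z; simp only [Finset.mem_sdiff, Finset.mem_insert, Finset.mem_erase]; grind
    · rcases hswap u hu with h | h <;> rw [h.2]
      exacts [hg.step u hu, hf.step u hu]
  obtain ⟨p', hp', hpw'⟩ := hf'.exists_isPathSystem hw V hSV
    (Finset.insert_subset htV' ((Finset.erase_subset _ _).trans hIV))
  obtain ⟨q', hq', hqw'⟩ := hg'.exists_isPathSystem hw V hSV
    (Finset.insert_subset htV ((Finset.erase_subset _ _).trans hJV))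
  obtain ⟨P', hP', hPw'⟩ := hp'.exists_isLinking w
  obtain ⟨Q', hQ', hQw'⟩ := hq'.exists_isLinking w
  refine ⟨t', htJ', htI', P', Q', hP', hQ', ?_⟩
  have hsum : ∑ u ∈ V \ S, stepCost w u (f' u) + ∑ u ∈ V \ S, stepCost w u (g' u) =
      ∑ u ∈ V \ S, stepCost w u (f u) + ∑ u ∈ V \ S, stepCost w u (g u) := by
    rw [← Finset.sum_add_distrib, ← Finset.sum_add_distrib]
    refine Finset.sum_congr rfl fun u hu => ?_
    rcases hswap u hu with ⟨h1, h2⟩ | ⟨h1, h2⟩ <;> rw [h1, h2]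
    exact add_comm _ _
  linarith

/-- Let `Γ` be a weighted digraph with no negative-weight cycles,
`[n]` among its vertices, and `S` a set of `d` vertices such that some `d`-subset of
`[n]` admits a linking onto `S`.  Let `μ(I)`, for `I` a `d`-subset of `[n]`, be the
minimum weight of a linking from `I` onto `S` (`∞` if there is none).  Then `μ`
satisfies the tropical Plücker relations: for all `S' ∈ C([n], d−1)` and
`T ∈ C([n], d+1)`, the minimum of `μ(S' ∪ t) + μ(T \ t)` over `t ∈ T \ S'` is
attained at least twice. -/
theorem stmt10 (n d : ℕ) (hd : 1 ≤ d)
    (E : ℕ → ℕ → Prop) (w : ℕ → ℕ → ℝ) (S : Finset ℕ) (hS : S.card = d)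
    (hNoNeg : ∀ p : List ℕ, p.Chain' E → 2 ≤ p.length → p.head? = p.getLast? →
      0 ≤ pathWeight w p)
    (hEx : ∃ I : Finset ℕ, I ⊆ Finset.Icc 1 n ∧ I.card = d ∧ ∃ P, IsLinking E I S P)
    (μ : Finset ℕ → WithTop ℝ)
    (hμ : ∀ I : Finset ℕ, I ⊆ Finset.Icc 1 n → I.card = d →
      IsLeast ({c : WithTop ℝ | ∃ P, IsLinking E I S P ∧
        c = ((linkingWeight w P : ℝ) : WithTop ℝ)} ∪ {⊤}) (μ I)) :
    ∀ S' T : Finset ℕ, S' ⊆ Finset.Icc 1 n → T ⊆ Finset.Icc 1 n →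
      S'.card = d - 1 → T.card = d + 1 →
      ∃ t₁ ∈ T \ S', ∃ t₂ ∈ T \ S', t₁ ≠ t₂ ∧
        μ (insert t₁ S') + μ (T.erase t₁) = μ (insert t₂ S') + μ (T.erase t₂) ∧
        ∀ t ∈ T \ S', μ (insert t₁ S') + μ (T.erase t₁) ≤ μ (insert t S') + μ (T.erase t) := by
  intro S' T hS' hT hS'c hTc
  have hsub : ∀ t ∈ T \ S', insert t S' ⊆ Finset.Icc 1 n ∧ (insert t S').card = d ∧
      T.erase t ⊆ Finset.Icc 1 n ∧ (T.erase t).card = d := by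
    intro t ht
    obtain ⟨htT, htS⟩ := Finset.mem_sdiff.1 ht
    refine ⟨Finset.insert_subset (hT htT) hS', ?_, (Finset.erase_subset _ _).trans hT, ?_⟩
    · rw [Finset.card_insert_of_notMem htS]
      omega
    · rw [Finset.card_erase_of_mem htT]
      omega
  have hcard : 1 < (T \ S').card := by
    have := Finset.le_card_sdiff S' T
    omega
  have hle : ∀ I ⊆ Finset.Icc 1 n, I.card = d → ∀ P, IsLinking E I S P →
      μ I ≤ ((linkingWeight w P : ℝ) : WithTop ℝ) := fun I hI hId P hP =>
    (hμ I hI hId).2 (Or.inl ⟨P, hP, rfl⟩)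
  obtain ⟨t₁, ht₁, hmin⟩ := Finset.exists_min_image (T \ S')
    (fun t => μ (insert t S') + μ (T.erase t)) (Finset.card_pos.1 (by omega))
  suffices h : ∃ t₂ ∈ T \ S', t₁ ≠ t₂ ∧
      μ (insert t₂ S') + μ (T.erase t₂) ≤ μ (insert t₁ S') + μ (T.erase t₁) by
    obtain ⟨t₂, ht₂, hne, h⟩ := h
    exact ⟨t₁, ht₁, t₂, ht₂, hne, le_antisymm (hmin t₂ ht₂) h, hmin⟩
  obtain ⟨hI, hIc, hJ, hJc⟩ := hsub t₁ ht₁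
  obtain ⟨ht₁T, ht₁S⟩ := Finset.mem_sdiff.1 ht₁
  obtain ⟨t₀, ht₀, hne₀⟩ := Finset.exists_mem_ne hcard t₁
  rcases (hμ _ hI hIc).1 with ⟨P, hP, hPw⟩ | htop
  swap
  · rw [Set.mem_singleton_iff] at htop
    exact ⟨t₀, ht₀, hne₀.symm, by simp [htop]⟩
  rcases (hμ _ hJ hJc).1 with ⟨Q, hQ, hQw⟩ | htop
  swap
  · rw [Set.mem_singleton_iff] at htop
    exact ⟨t₀, ht₀, hne₀.symm, by simp [htop]⟩
  obtain ⟨t', ht'J, ht'I, P', Q', hP', hQ', hw'⟩ :=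
    hP.exchange hNoNeg hQ (Finset.mem_insert_self t₁ S') (Finset.notMem_erase t₁ T)
  obtain ⟨htne, ht'T⟩ := Finset.mem_erase.1 ht'J
  have ht'S : t' ∉ S' := fun h => ht'I (Finset.mem_insert_of_mem h)
  rw [Finset.erase_insert ht₁S] at hP'
  have hT' : insert t₁ ((T.erase t₁).erase t') = T.erase t' := by
    rw [Finset.erase_right_comm, Finset.insert_erase (Finset.mem_erase.2 ⟨htne.symm, ht₁T⟩)]
  rw [hT'] at hQ'
  have ht' : t' ∈ T \ S' := Finset.mem_sdiff.2 ⟨ht'T, ht'S⟩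
  obtain ⟨hI', hIc', hJ', hJc'⟩ := hsub t' ht'
  refine ⟨t', ht', htne.symm, ?_⟩
  rw [hPw, hQw]
  refine (add_le_add (hle _ hI' hIc' P' hP') (hle _ hJ' hJc' Q' hQ')).trans ?_
  exact_mod_cast hw'
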